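/- Let α be an admissible exponent of A and suppose G_α is bounded below on c00(α), i.e., there exists θ > 0 with ‖u‖_α ≤ θ‖G_α u‖_α for all u ∈ c00(α) (equivalently, 0 does not belong to the approximate point spectrum of G_α). If for some fixed n ∈ ℕ and x₀ ∈ E one has sup_{m≥n} ‖A(m,n)x₀‖ < ∞, then there exist a constant ν > 0 and a positive real sequence (N_k)_{k∈ℕ}, both independent of n and x₀, such that ‖A(m,n)x₀‖ ≤ N_n e^{−ν(m−n)} ‖x₀‖ for all m ≥ n. -/

import Mathlib

open Filter Topology

variable {E : Type*} [NormedAddCommGroup E] [NormedSpace ℝ E] [CompleteSpace E]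

/-- `evol A n m` is the evolution operator `A(m,n) = A_{m-1} ∘ ⋯ ∘ A_n`
(the identity if `m ≤ n`). -/
def evol (A : ℕ → E →L[ℝ] E) (n : ℕ) : ℕ → E →L[ℝ] E
  | 0 => 1
  | m + 1 => if n ≤ m then A m * evol A n m else 1

/-- `α` is an admissible exponent for `A`: there is a positive sequence `M` with
`‖A(m,n)‖ ≤ M n * e^{α (m - n)}` for all `m ≥ n`. -/
def IsAdmissible (A : ℕ → E →L[ℝ] E) (α : ℝ) : Prop :=
  ∃ M : ℕ → ℝ, (∀ n, 0 < M n) ∧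
    ∀ m n : ℕ, n ≤ m → ‖evol A n m‖ ≤ M n * Real.exp (α * ((m : ℝ) - (n : ℝ)))

/-- The norm `‖x‖_{n,α} = sup_{m ≥ n} e^{-α(m-n)} ‖A(m,n) x‖`. -/
noncomputable def nnorm (A : ℕ → E →L[ℝ] E) (α : ℝ) (n : ℕ) (x : E) : ℝ :=
  ⨆ m : Set.Ici n, Real.exp (-α * (((m : ℕ) : ℝ) - (n : ℝ))) * ‖evol A n (m : ℕ) x‖

/-- Membership in `c00(α)`: `u 0 = 0` and `‖u n‖_{n,α} → 0`. -/
def MemC00 (A : ℕ → E →L[ℝ] E) (α : ℝ) (u : ℕ → E) : Prop :=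
  u 0 = 0 ∧ Tendsto (fun n => nnorm A α n (u n)) atTop (𝓝 0)

/-- The norm `‖u‖_α = sup_n ‖u n‖_{n,α}` on `c00(α)`. -/
noncomputable def cnorm (A : ℕ → E →L[ℝ] E) (α : ℝ) (u : ℕ → E) : ℝ :=
  ⨆ n, nnorm A α n (u n)

/-- The evolution map `T`: `(Tu)_0 = 0`, `(Tu)_{n+1} = A_n u_n`. -/
def Tmap (A : ℕ → E →L[ℝ] E) (u : ℕ → E) : ℕ → E
  | 0 => 0
  | m + 1 => A m (u m)

/-- `G = T - Id`. -/
def Gmap (A : ℕ → E →L[ℝ] E) (u : ℕ → E) : ℕ → E :=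
  fun n => Tmap A u n - u n

omit [CompleteSpace E] in
theorem evol_self (A : ℕ → E →L[ℝ] E) (n : ℕ) : evol A n n = 1 := by
  cases n with
  | zero => rfl
  | succ k => simp [evol]

omit [CompleteSpace E] in
theorem evol_succ (A : ℕ → E →L[ℝ] E) {n m : ℕ} (h : n ≤ m) (x : E) :
    evol A n (m + 1) x = A m (evol A n m x) := by
  simp [evol, h]

omit [CompleteSpace E] in
theorem evol_evol (A : ℕ → E →L[ℝ] E) {n m k : ℕ} (hnm : n ≤ m) (hmk : m ≤ k) (x : E) :
    evol A m k (evol A n m x) = evol A n k x := by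
  induction k, hmk using Nat.le_induction with
  | base => simp [evol_self]
  | succ k hk ih => rw [evol_succ A hk, evol_succ A (hnm.trans hk), ih]

omit [CompleteSpace E] in
theorem nnorm_nonneg (A : ℕ → E →L[ℝ] E) (α : ℝ) (n : ℕ) (x : E) : 0 ≤ nnorm A α n x :=
  Real.iSup_nonneg fun _ => by positivity

omit [CompleteSpace E] in
theorem nnorm_smul (A : ℕ → E →L[ℝ] E) (α : ℝ) (n : ℕ) (c : ℝ) (x : E) :
    nnorm A α n (c • x) = |c| * nnorm A α n x := by
  unfold nnorm
  rw [Real.mul_iSup_of_nonneg (abs_nonneg c)]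
  refine iSup_congr fun m => ?_
  rw [map_smul, norm_smul, Real.norm_eq_abs]
  ring

omit [CompleteSpace E] in
theorem weighted_norm_evol_le {A : ℕ → E →L[ℝ] E} {α M : ℝ} {n : ℕ}
    (hM : ∀ m, n ≤ m → ‖evol A n m‖ ≤ M * Real.exp (α * ((m : ℝ) - (n : ℝ))))
    (x : E) {m : ℕ} (hm : n ≤ m) :
    Real.exp (-α * ((m : ℝ) - (n : ℝ))) * ‖evol A n m x‖ ≤ M * ‖x‖ := by
  have h := (evol A n m).le_of_opNorm_le (hM m hm) x
  calc Real.exp (-α * ((m : ℝ) - (n : ℝ))) * ‖evol A n m x‖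
      ≤ Real.exp (-α * ((m : ℝ) - (n : ℝ))) *
          (M * Real.exp (α * ((m : ℝ) - (n : ℝ))) * ‖x‖) := by gcongr
    _ = Real.exp (-α * ((m : ℝ) - (n : ℝ)) + α * ((m : ℝ) - (n : ℝ))) * (M * ‖x‖) := by
        rw [Real.exp_add]; ring
    _ = M * ‖x‖ := by simp

omit [CompleteSpace E] in
theorem nnorm_le_mul_norm {A : ℕ → E →L[ℝ] E} {α M : ℝ} {n : ℕ}
    (hM : ∀ m, n ≤ m → ‖evol A n m‖ ≤ M * Real.exp (α * ((m : ℝ) - (n : ℝ)))) (x : E) :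
    nnorm A α n x ≤ M * ‖x‖ :=
  have : Nonempty (Set.Ici n) := ⟨⟨n, Set.self_mem_Ici⟩⟩
  ciSup_le fun m => weighted_norm_evol_le hM x m.2

omit [CompleteSpace E] in
theorem IsAdmissible.norm_le_nnorm {A : ℕ → E →L[ℝ] E} {α : ℝ} (hα : IsAdmissible A α)
    (n : ℕ) (x : E) : ‖x‖ ≤ nnorm A α n x := by
  obtain ⟨M, -, hM⟩ := hα
  have hb : BddAbove (Set.range fun m : Set.Ici n =>
      Real.exp (-α * (((m : ℕ) : ℝ) - (n : ℝ))) * ‖evol A n (m : ℕ) x‖) :=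
    ⟨M n * ‖x‖, by
      rintro _ ⟨m, rfl⟩
      exact weighted_norm_evol_le (fun k hk => hM k n hk) x m.2⟩
  simpa [evol_self, nnorm] using le_ciSup hb ⟨n, Set.self_mem_Ici⟩

omit [CompleteSpace E] in
theorem nnorm_evol_le_of_bound {A : ℕ → E →L[ℝ] E} {α : ℝ} (hα : 0 ≤ α) {n : ℕ} {x : E} {K : ℝ}
    (hK : ∀ m, n ≤ m → ‖evol A n m x‖ ≤ K) {m : ℕ} (hm : n ≤ m) :
    nnorm A α m (evol A n m x) ≤ K := by
  have : Nonempty (Set.Ici m) := ⟨⟨m, Set.self_mem_Ici⟩⟩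
  refine ciSup_le fun k => ?_
  have hk : m ≤ (k : ℕ) := k.2
  have hk' : (m : ℝ) ≤ ((k : ℕ) : ℝ) := by exact_mod_cast hk
  rw [evol_evol A hm hk]
  refine (mul_le_of_le_one_left (norm_nonneg _) ?_).trans (hK k (hm.trans hk))
  rw [Real.exp_le_one_iff, neg_mul, neg_nonpos]
  exact mul_nonneg hα (sub_nonneg.2 hk')

/-- The weight `q ^ |m - L|`, peaked at `L`. -/
def peakWeight (q : ℝ) (L m : ℕ) : ℝ := q ^ ((m - L) + (L - m))

theorem peakWeight_pos {q : ℝ} (hq : 0 < q) (L m : ℕ) : 0 < peakWeight q L m :=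
  pow_pos hq _

theorem tendsto_peakWeight {q : ℝ} (h0 : 0 < q) (h1 : q < 1) (L : ℕ) :
    Tendsto (peakWeight q L) atTop (𝓝 0) := by
  refine (tendsto_pow_atTop_nhds_zero_of_lt_one h0.le h1).comp
    (tendsto_atTop_mono (fun m => ?_) (tendsto_sub_atTop_nat L))
  omega

theorem abs_peakWeight_sub_le {r : ℝ} (hr : 1 < r) (L m : ℕ) :
    |peakWeight r⁻¹ L m - peakWeight r⁻¹ L (m + 1)| ≤ (r - 1) * peakWeight r⁻¹ L (m + 1) := by
  have hr0 : r ≠ 0 := by positivity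
  have hp := peakWeight_pos (inv_pos.2 (zero_lt_one.trans hr)) L m
  have hp' := peakWeight_pos (inv_pos.2 (zero_lt_one.trans hr)) L (m + 1)
  rcases Nat.lt_or_ge m L with h | h
  · have e : peakWeight r⁻¹ L (m + 1) = r * peakWeight r⁻¹ L m := by
      unfold peakWeight
      rw [show (m - L) + (L - m) = ((m + 1 - L) + (L - (m + 1))) + 1 by omega, pow_succ]
      field_simp
    rw [abs_le, e]
    constructor <;> nlinarith [mul_pos (sub_pos.2 hr) hp,
      mul_pos (mul_pos (sub_pos.2 hr) (sub_pos.2 hr)) hp]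
  · have e : peakWeight r⁻¹ L m = r * peakWeight r⁻¹ L (m + 1) := by
      unfold peakWeight
      rw [show (m + 1 - L) + (L - (m + 1)) = ((m - L) + (L - m)) + 1 by omega, pow_succ]
      field_simp
    rw [abs_le, e]
    constructor <;> nlinarith [mul_pos (sub_pos.2 hr) hp']

omit [CompleteSpace E] in
theorem nnorm_evol_le_of_bounded_below {A : ℕ → E →L[ℝ] E} {α : ℝ} (hα : 0 ≤ α) {θ : ℝ}
    (hθ : 0 < θ) (hbelow : ∀ u, MemC00 A α u → cnorm A α u ≤ θ * cnorm A α (Gmap A u))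
    {n : ℕ} (hn : 1 ≤ n) {x : E} {K : ℝ} (hK : ∀ m, n ≤ m → ‖evol A n m x‖ ≤ K)
    {L : ℕ} (hL : n ≤ L) :
    nnorm A α L (evol A n L x) ≤ 2 * θ * (1 + 1 / (2 * θ))⁻¹ ^ (L - n) * nnorm A α n x := by
  set r : ℝ := 1 + 1 / (2 * θ) with hr
  have hr1 : 1 < r := by rw [hr]; linarith [show 0 < 1 / (2 * θ) by positivity]
  have hθr : θ * (r - 1) = 1 / 2 := by rw [hr]; field_simp; ring
  have hq0 : 0 < r⁻¹ := inv_pos.2 (zero_lt_one.trans hr1)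
  have hK0 : 0 ≤ K := (norm_nonneg _).trans (hK n le_rfl)
  have hφ := peakWeight_pos hq0 L
  let u : ℕ → E := fun m => if n ≤ m then peakWeight r⁻¹ L m • evol A n m x else 0
  have hnn0 : ∀ m, nnorm A α m 0 = 0 := fun m => by simp [nnorm]
  have hnu : ∀ m, n ≤ m →
      nnorm A α m (u m) = peakWeight r⁻¹ L m * nnorm A α m (evol A n m x) := fun m hm => by
    simp only [u, if_pos hm, nnorm_smul, abs_of_pos (hφ m)]
  have hu0 : ∀ m, ¬ n ≤ m → u m = 0 := fun m hm => if_neg hm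
  have hnu_le : ∀ m, nnorm A α m (u m) ≤ peakWeight r⁻¹ L m * K := fun m => by
    by_cases hm : n ≤ m
    · rw [hnu m hm]
      exact mul_le_mul_of_nonneg_left (nnorm_evol_le_of_bound hα hK hm) (hφ m).le
    · rw [hu0 m hm, hnn0]
      exact mul_nonneg (hφ m).le hK0
  have hlim : Tendsto (fun m => nnorm A α m (u m)) atTop (𝓝 0) := by
    refine squeeze_zero (fun m => nnorm_nonneg A α m _) hnu_le ?_
    simpa using (tendsto_peakWeight hq0 (inv_lt_one_of_one_lt₀ hr1) L).mul_const K
  have hmem : MemC00 A α u := ⟨hu0 0 (by omega), hlim⟩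
  have hle : ∀ m, nnorm A α m (u m) ≤ cnorm A α u := le_ciSup hlim.bddAbove_range
  have hc0 : 0 ≤ cnorm A α u := (nnorm_nonneg A α 0 _).trans (hle 0)
  have hs0 : 0 ≤ r⁻¹ ^ (L - n) * nnorm A α n x :=
    mul_nonneg (by positivity) (nnorm_nonneg A α n x)
  have hG : cnorm A α (Gmap A u) ≤
      r⁻¹ ^ (L - n) * nnorm A α n x + (r - 1) * cnorm A α u := by
    have hrc : 0 ≤ (r - 1) * cnorm A α u := mul_nonneg (sub_pos.2 hr1).le hc0
    refine ciSup_le fun m => ?_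
    rcases lt_trichotomy m n with hm | rfl | hm
    · have : Gmap A u m = 0 := by
        cases m with
        | zero => simp [Gmap, Tmap, hu0 0 (by omega)]
        | succ k => simp [Gmap, Tmap, hu0 k (by omega), hu0 (k + 1) (by omega)]
      rw [this, hnn0]
      positivity
    · have : Gmap A u m = (-peakWeight r⁻¹ L m) • x := by
        obtain ⟨k, rfl⟩ : ∃ k, m = k + 1 := ⟨m - 1, by omega⟩
        simp [Gmap, Tmap, u, evol_self]
      have hw : peakWeight r⁻¹ L m = r⁻¹ ^ (L - m) := by
        rw [peakWeight, Nat.sub_eq_zero_of_le hL, zero_add]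
      rw [this, nnorm_smul, abs_neg, abs_of_pos (hφ m), hw]
      linarith
    · obtain ⟨k, rfl⟩ : ∃ k, m = k + 1 := ⟨m - 1, by omega⟩
      have hk : n ≤ k := by omega
      have : Gmap A u (k + 1) =
          (peakWeight r⁻¹ L k - peakWeight r⁻¹ L (k + 1)) • evol A n (k + 1) x := by
        simp only [Gmap, Tmap, u, if_pos hk, if_pos hm.le, map_smul, evol_succ A hk, sub_smul]
      rw [this, nnorm_smul]
      calc |peakWeight r⁻¹ L k - peakWeight r⁻¹ L (k + 1)| *
            nnorm A α (k + 1) (evol A n (k + 1) x)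
          ≤ (r - 1) * peakWeight r⁻¹ L (k + 1) * nnorm A α (k + 1) (evol A n (k + 1) x) :=
            mul_le_mul_of_nonneg_right (abs_peakWeight_sub_le hr1 L k) (nnorm_nonneg A α _ _)
        _ = (r - 1) * nnorm A α (k + 1) (u (k + 1)) := by rw [hnu _ hm.le, mul_assoc]
        _ ≤ (r - 1) * cnorm A α u :=
            mul_le_mul_of_nonneg_left (hle _) (sub_pos.2 hr1).le
        _ ≤ _ := le_add_of_nonneg_left hs0
  have hLu : nnorm A α L (evol A n L x) = nnorm A α L (u L) := by
    rw [hnu L hL]; simp [peakWeight]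
  rw [hLu]
  have h1 := hle L
  have h2 := hbelow u hmem
  have h3 := mul_le_mul_of_nonneg_left hG hθ.le
  have h4 : θ * ((r - 1) * cnorm A α u) = 1 / 2 * cnorm A α u := by rw [← mul_assoc, hθr]
  linarith

/-- If `0 ∉ σ_ap(G_α)`, i.e. `‖u‖_α ≤ θ ‖G_α u‖_α` on `c00(α)` for some
`θ > 0`, then there are `ν > 0` and a positive sequence `(N_k)`, independent of `n`
and `x₀`, such that every bounded orbit satisfies
`‖A(m,n) x₀‖ ≤ N_n e^{-ν(m-n)} ‖x₀‖` for `m ≥ n`. -/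
theorem stmt9 (A : ℕ → E →L[ℝ] E) (α : ℝ) (hα : IsAdmissible A α)
    (θ : ℝ) (hθ : 0 < θ)
    (hbelow : ∀ u, MemC00 A α u → cnorm A α u ≤ θ * cnorm A α (Gmap A u)) :
    ∃ ν : ℝ, 0 < ν ∧ ∃ N : ℕ → ℝ, (∀ k, 0 < N k) ∧
      ∀ (n : ℕ) (x₀ : E),
        BddAbove (Set.range fun m : Set.Ici n => ‖evol A n (m : ℕ) x₀‖) →
        ∀ m : ℕ, n ≤ m →
          ‖evol A n m x₀‖ ≤ N n * Real.exp (-ν * ((m : ℝ) - (n : ℝ))) * ‖x₀‖ := by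
  obtain ⟨M, hM0, hM⟩ := id hα
  rcases lt_or_ge α 0 with hneg | hα0
  · refine ⟨-α, neg_pos.2 hneg, M, hM0, fun n x₀ _ m hm => ?_⟩
    simpa using (evol A n m).le_of_opNorm_le (hM m n hm) x₀
  set r : ℝ := 1 + 1 / (2 * θ) with hr
  have hr1 : 1 < r := by rw [hr]; linarith [show 0 < 1 / (2 * θ) by positivity]
  have hr0 : 0 < r := zero_lt_one.trans hr1
  have hexp : ∀ {n m : ℕ}, n ≤ m →
      Real.exp (-Real.log r * ((m : ℝ) - (n : ℝ))) = r⁻¹ ^ (m - n) := fun {n m} h => by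
    rw [← Nat.cast_sub h, mul_comm, Real.exp_nat_mul, Real.exp_neg, Real.exp_log hr0]
  have key : ∀ (n : ℕ), 1 ≤ n → ∀ (x : E) (K : ℝ), (∀ m, n ≤ m → ‖evol A n m x‖ ≤ K) →
      ∀ m, n ≤ m → ‖evol A n m x‖ ≤ 2 * θ * r⁻¹ ^ (m - n) * (M n * ‖x‖) :=
    fun n hn x K hK m hm =>
      ((hα.norm_le_nnorm m _).trans
        (nnorm_evol_le_of_bounded_below hα0 hθ hbelow hn hK hm)).trans
        (mul_le_mul_of_nonneg_left (nnorm_le_mul_norm (fun k hk => hM k n hk) x) (by positivity))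
  refine ⟨Real.log r, Real.log_pos hr1,
    fun n => if n = 0 then 2 * θ * r * M 1 * ‖A 0‖ + 1 else 2 * θ * M n, fun n => ?_,
    fun n x₀ hbdd m hm => ?_⟩
  · have := hM0 n
    have := hM0 1
    dsimp only
    split_ifs <;> positivity
  obtain ⟨K, hK⟩ := hbdd
  have hK' : ∀ m, n ≤ m → ‖evol A n m x₀‖ ≤ K := fun m hm => hK ⟨⟨m, hm⟩, rfl⟩
  rw [hexp hm]
  dsimp only
  have hM1 := hM0 1
  rcases Nat.eq_zero_or_pos n with rfl | hn
  · rw [if_pos rfl]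
    cases m with
    | zero =>
      have : 0 ≤ 2 * θ * r * M 1 * ‖A 0‖ * ‖x₀‖ := by positivity
      simp only [evol_self, one_apply_eq_self, Nat.sub_self, pow_zero, mul_one]
      linarith
    | succ m =>
      have hx : evol A 0 1 x₀ = A 0 x₀ := by simp [evol]
      have h := key 1 le_rfl (A 0 x₀) K (fun k hk => by
        rw [← hx, evol_evol A zero_le_one hk]; exact hK' k (Nat.zero_le k)) (m + 1) (by omega)
      rw [← hx, evol_evol A zero_le_one (by omega), hx, Nat.add_sub_cancel] at h
      calc ‖evol A 0 (m + 1) x₀‖ ≤ 2 * θ * r⁻¹ ^ m * (M 1 * ‖A 0 x₀‖) := h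
        _ ≤ 2 * θ * r⁻¹ ^ m * (M 1 * (‖A 0‖ * ‖x₀‖)) := by
            gcongr
            exact (A 0).le_opNorm x₀
        _ = 2 * θ * r * M 1 * ‖A 0‖ * r⁻¹ ^ (m + 1) * ‖x₀‖ := by
            rw [pow_succ]
            field_simp
        _ ≤ (2 * θ * r * M 1 * ‖A 0‖ + 1) * r⁻¹ ^ (m + 1 - 0) * ‖x₀‖ := by
            rw [Nat.sub_zero]
            gcongr
            linarith
  · rw [if_neg hn.ne']
    exact (key n hn x₀ K hK' m hm).trans_eq (by ring)
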